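/- Let d ≥ 1 and let P and Q be finite partially ordered sets on [d] = {1,...,d}. Then each of Γ(O_P, C_Q) = conv(O_P ∪ (−C_Q)) ⊂ ℝ^d and Ω(O_P, C_Q) = conv((O_P × {1}) ∪ ((−C_Q) × {−1})) ⊂ ℝ^{d+1} is a reflexive polytope with the integer decomposition property. -/

import Mathlib

open scoped Pointwise

namespace HibiTsuchiya

/-- A point of `ℝ^n` is a *lattice point* if all of its coordinates are integers. -/
def IsLatticePoint {n : ℕ} (x : Fin n → ℝ) : Prop := ∀ i, ∃ z : ℤ, x i = (z : ℝ)

/-- The dual polytope `P^∨ = {x : ⟨x,y⟩ ≤ 1 for all y ∈ P}`. -/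
def dualPolytope {n : ℕ} (P : Set (Fin n → ℝ)) : Set (Fin n → ℝ) :=
  {x | ∀ y ∈ P, ∑ i, x i * y i ≤ 1}

/-- A polytope `P ⊆ ℝ^n` is *reflexive* if the origin is an interior point of `P` and the
dual polytope of `P` is again a lattice polytope (i.e. the convex hull of finitely many
lattice points). -/
def IsReflexive {n : ℕ} (P : Set (Fin n → ℝ)) : Prop :=
  0 ∈ interior P ∧
    ∃ V : Finset (Fin n → ℝ), (∀ v ∈ V, IsLatticePoint v) ∧
      dualPolytope P = convexHull ℝ (V : Set (Fin n → ℝ))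

/-- `P` has the *integer decomposition property* if every lattice point of `m • P` (`m ≥ 1`)
is a sum of `m` lattice points of `P`. -/
def HasIDP {n : ℕ} (P : Set (Fin n → ℝ)) : Prop :=
  ∀ m : ℕ, 0 < m → ∀ a : Fin n → ℝ, IsLatticePoint a → a ∈ (m : ℝ) • P →
    ∃ f : Fin m → Fin n → ℝ, (∀ k, f k ∈ P ∧ IsLatticePoint (f k)) ∧ a = ∑ k, f k

/-- The indicator vector `ρ(S) = ∑_{j ∈ S} e_j` of a subset `S ⊆ [n]`. -/
noncomputable def indicator {n : ℕ} (S : Set (Fin n)) : Fin n → ℝ :=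
  S.indicator (fun _ => (1 : ℝ))

/-- A poset ideal of a partial order `P` on `[n]`. -/
def IsPosetIdeal {n : ℕ} (P : PartialOrder (Fin n)) (I : Set (Fin n)) : Prop :=
  ∀ i ∈ I, ∀ j, P.le j i → j ∈ I

/-- The order polytope `O_P`: the convex hull of the indicator vectors of poset ideals. -/
noncomputable def orderPolytope {n : ℕ} (P : PartialOrder (Fin n)) : Set (Fin n → ℝ) :=
  convexHull ℝ {x | ∃ I : Set (Fin n), IsPosetIdeal P I ∧ x = indicator I}

/-- An antichain of a partial order `P` on `[n]`: a pairwise incomparable subset. -/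
def IsPosetAntichain {n : ℕ} (P : PartialOrder (Fin n)) (A : Set (Fin n)) : Prop :=
  ∀ i ∈ A, ∀ j ∈ A, i ≠ j → ¬ P.le i j ∧ ¬ P.le j i

/-- The chain polytope `C_P`: the convex hull of the indicator vectors of antichains. -/
noncomputable def chainPolytope {n : ℕ} (P : PartialOrder (Fin n)) : Set (Fin n → ℝ) :=
  convexHull ℝ {x | ∃ A : Set (Fin n), IsPosetAntichain P A ∧ x = indicator A}

/-- A stable (independent) set of a graph. -/
def IsStableSet {V : Type*} (G : SimpleGraph V) (S : Set V) : Prop :=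
  ∀ i ∈ S, ∀ j ∈ S, ¬ G.Adj i j

/-- The stable set polytope `Q_G`: the convex hull of the indicator vectors of stable sets. -/
noncomputable def stableSetPolytope {n : ℕ} (G : SimpleGraph (Fin n)) : Set (Fin n → ℝ) :=
  convexHull ℝ {x | ∃ S : Set (Fin n), IsStableSet G S ∧ x = indicator S}

/-- The clique number of a graph, as an extended natural number. -/
noncomputable def cliqueNumber {V : Type*} (G : SimpleGraph V) : ℕ∞ :=
  ⨆ (t : Finset V) (_ : G.IsClique (t : Set V)), (t.card : ℕ∞)

/-- A graph is *perfect* if for every induced subgraph (including the graph itself)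
the chromatic number equals the clique number. -/
def IsPerfectGraph {V : Type*} (G : SimpleGraph V) : Prop :=
  ∀ s : Set V, (G.induce s).chromaticNumber = cliqueNumber (G.induce s)

/-- A simplicial complex on the vertex set `[n]`. -/
def IsSimplicialComplex {n : ℕ} (Δ : Set (Finset (Fin n))) : Prop :=
  (∀ i : Fin n, {i} ∈ Δ) ∧ ∀ F ∈ Δ, ∀ F' ⊆ F, F' ∈ Δ

/-- The polytope `P_Δ`: the convex hull of the indicator vectors of the faces of `Δ`. -/
noncomputable def complexPolytope {n : ℕ} (Δ : Set (Finset (Fin n))) : Set (Fin n → ℝ) :=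
  convexHull ℝ {x | ∃ F ∈ Δ, x = indicator (↑F : Set (Fin n))}

/-- `Γ(P,Q) = conv(P ∪ (−Q))`. -/
noncomputable def gammaPolytope {n : ℕ} (P Q : Set (Fin n → ℝ)) : Set (Fin n → ℝ) :=
  convexHull ℝ (P ∪ -Q)

/-- `Ω(P,Q) = conv((P × {1}) ∪ ((−Q) × {−1})) ⊆ ℝ^{n+1}`. -/
noncomputable def omegaPolytope {n : ℕ} (P Q : Set (Fin n → ℝ)) : Set (Fin (n+1) → ℝ) :=
  convexHull ℝ
    ((fun x : Fin n → ℝ => Fin.snoc x (1 : ℝ)) '' P ∪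
     (fun x : Fin n → ℝ => Fin.snoc x (-1 : ℝ)) '' (-Q))

lemma dot_le_convexHull {n : ℕ} {S : Set (Fin n → ℝ)} {v : Fin n → ℝ} {b : ℝ}
    (h : ∀ g ∈ S, ∑ i, v i * g i ≤ b) : ∀ g ∈ convexHull ℝ S, ∑ i, v i * g i ≤ b := by
  have hc : Convex ℝ {g : Fin n → ℝ | ∑ i, v i * g i ≤ b} := by
    apply convex_halfSpace_le
    constructor
    · intro x y
      simp [mul_add, Finset.sum_add_distrib]
    · intro c x
      simp only [Pi.smul_apply, smul_eq_mul, Finset.mul_sum]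
      exact Finset.sum_congr rfl fun i _ => by ring
  exact fun g hg => convexHull_min h hc hg

lemma lattice_dot {n : ℕ} {v a : Fin n → ℝ} (hv : IsLatticePoint v) (ha : IsLatticePoint a) :
    ∃ z : ℤ, ∑ i, v i * a i = (z : ℝ) := by
  choose p hp using hv
  choose q hq using ha
  exact ⟨∑ i, p i * q i, by push_cast; simp [hp, hq]⟩

lemma abstract_zero_interior {n : ℕ} (K : Set (Fin n → ℝ)) (hK : Convex ℝ K)
    (V : Finset (Fin n → ℝ))
    (H3 : ∀ (a : Fin n → ℝ) (m : ℕ), IsLatticePoint a → (∀ v ∈ V, ∑ i, v i * a i ≤ m) →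
      ∃ f : Fin m → Fin n → ℝ, (∀ k, f k ∈ K ∧ IsLatticePoint (f k)) ∧ a = ∑ k, f k) :
    0 ∈ interior K := by
  obtain ⟨m, hm⟩ := exists_nat_gt (∑ v ∈ V, ∑ i, |v i|)
  have hm0 : (0 : ℝ) < m := lt_of_le_of_lt (by positivity) hm
  have hcorner : ∀ e : Fin n → ℝ, (∀ i, e i = -1 ∨ e i = 1) → (m : ℝ)⁻¹ • e ∈ K := by
    intro e he
    obtain ⟨f, hf, hsum⟩ := H3 e m
      (fun i => by
        rcases he i with h | h
        · exact ⟨-1, by simp [h]⟩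
        · exact ⟨1, by simp [h]⟩)
      (fun v hv => by
        have h1 : ∑ i, v i * e i ≤ ∑ i, |v i| := by
          apply Finset.sum_le_sum
          intro i _
          rcases he i with h | h
          · rw [h]; simpa using neg_le_abs (v i)
          · rw [h]; simpa using le_abs_self (v i)
        have h2 : ∑ i, |v i| ≤ ∑ v ∈ V, ∑ i, |v i| :=
          Finset.single_le_sum (f := fun v : Fin n → ℝ => ∑ i, |v i|)
            (fun _ _ => by positivity) hv
        linarith)
    rw [hsum, Finset.smul_sum]
    apply hK.sum_mem
    · intro i _; positivity
    · simp [hm0.ne']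
    · intro i _; exact (hf i).1
  have hsub : (Set.univ : Set (Fin n)).pi (fun _ => Set.Icc (-(m : ℝ)⁻¹) ((m : ℝ)⁻¹)) ⊆ K := by
    have : (Set.univ : Set (Fin n)).pi (fun _ => Set.Icc (-(m : ℝ)⁻¹) ((m : ℝ)⁻¹)) =
        convexHull ℝ ((Set.univ : Set (Fin n)).pi (fun _ => {(-(m : ℝ)⁻¹), ((m : ℝ)⁻¹)})) := by
      rw [convexHull_pi]
      congr 1
      funext i
      rw [convexHull_pair, segment_eq_Icc]
      have : (0 : ℝ) < (m : ℝ)⁻¹ := by positivity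
      linarith
    rw [this]
    apply convexHull_min _ hK
    intro x hx
    have := hcorner ((m : ℝ) • x) (fun i => by
      have := hx i (Set.mem_univ i)
      simp only [Set.mem_insert_iff, Set.mem_singleton_iff] at this
      rcases this with h | h
      · left; simp [h, hm0.ne']
      · right; simp [h, hm0.ne'])
    rwa [smul_smul, inv_mul_cancel₀ hm0.ne', one_smul] at this
  rw [mem_interior_iff_mem_nhds]
  refine Filter.mem_of_superset ?_ hsub
  apply set_pi_mem_nhds Set.finite_univ
  intro i _
  have : (0 : ℝ) < (m : ℝ)⁻¹ := by positivity
  exact Icc_mem_nhds (by simpa using this) (by simpa using this)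

lemma abstract_dual {n : ℕ} (K : Set (Fin n → ℝ))
    (V : Finset (Fin n → ℝ)) (hV : ∀ v ∈ V, IsLatticePoint v) (hV0 : 0 ∈ V)
    (H2 : ∀ v ∈ V, ∀ g ∈ K, ∑ i, v i * g i ≤ 1)
    (H3 : ∀ (a : Fin n → ℝ) (m : ℕ), IsLatticePoint a → (∀ v ∈ V, ∑ i, v i * a i ≤ m) →
      ∃ f : Fin m → Fin n → ℝ, (∀ k, f k ∈ K ∧ IsLatticePoint (f k)) ∧ a = ∑ k, f k) :
    dualPolytope K = convexHull ℝ (V : Set (Fin n → ℝ)) := by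
  apply Set.Subset.antisymm
  · intro z hz
    by_contra hzV
    have hclosed : IsClosed (convexHull ℝ (V : Set (Fin n → ℝ))) :=
      Set.Finite.isClosed_convexHull ℝ V.finite_toSet
    obtain ⟨f, u, hf1, hf2⟩ := geometric_hahn_banach_closed_point (convex_convexHull ℝ _) hclosed hzV
    have hfd : ∀ y : Fin n → ℝ, f y = ∑ i, y i * f (Pi.single i 1) := by
      intro y
      conv_lhs => rw [← Finset.univ_sum_single y]
      rw [map_sum]
      refine Finset.sum_congr rfl fun i _ => ?_
      have : (Pi.single i (y i) : Fin n → ℝ) = y i • Pi.single i 1 := by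
        rw [← Pi.single_smul]; simp
      rw [this, map_smul, smul_eq_mul]
    let U : Set (Fin n → ℝ) := ⋂ v ∈ V, {a | ∑ i, v i * a i < ∑ i, z i * a i}
    have hUo : IsOpen U := by
      apply isOpen_biInter_finset
      intro v _
      apply isOpen_lt <;> fun_prop
    have hUne : U.Nonempty := by
      refine ⟨fun i => f (Pi.single i 1), ?_⟩
      simp only [U, Set.mem_iInter, Set.mem_ofPred_eq]
      intro v hv
      rw [← hfd, ← hfd]
      exact (hf1 v (subset_convexHull ℝ _ hv)).trans hf2
    have hdense : DenseRange (fun q : Fin n → ℚ => fun i => (q i : ℝ)) :=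
      DenseRange.piMap (fun _ => Rat.denseRange_cast)
    obtain ⟨q, hq⟩ := hdense.exists_mem_open hUo hUne
    simp only [U, Set.mem_iInter, Set.mem_ofPred_eq] at hq
    let N : ℕ := ∏ i, (q i).den
    have hN : 0 < N := Finset.prod_pos fun i _ => (q i).den_pos
    have hNr : (0 : ℝ) < N := by exact_mod_cast hN
    let a : Fin n → ℝ := fun i => (N : ℝ) * (q i : ℝ)
    have ha : IsLatticePoint a := by
      intro i
      obtain ⟨c, hc⟩ : (q i).den ∣ N := Finset.dvd_prod_of_mem _ (Finset.mem_univ i)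
      refine ⟨c * (q i).num, ?_⟩
      have h1 : ((q i).den : ℝ) * (q i : ℝ) = (q i).num := by
        exact_mod_cast Rat.den_mul_eq_num (q i)
      simp only [a, hc]
      push_cast
      rw [← h1]; ring
    have hdot : ∀ w : Fin n → ℝ, ∑ i, w i * a i = N * ∑ i, w i * (q i : ℝ) := by
      intro w
      rw [Finset.mul_sum]
      exact Finset.sum_congr rfl fun i _ => by simp only [a]; ring
    obtain ⟨v0, hv0, hmax⟩ := Finset.exists_max_image V (fun v => ∑ i, v i * a i) ⟨0, hV0⟩
    obtain ⟨c, hc⟩ := lattice_dot (hV v0 hv0) ha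
    have hc0 : 0 ≤ c := by
      have := hmax 0 hV0
      simp only [Pi.zero_apply, zero_mul, Finset.sum_const_zero] at this
      rw [hc] at this
      exact_mod_cast this
    lift c to ℕ using hc0
    obtain ⟨g, hg, hsum⟩ := H3 a c ha (fun v hv => by
      have := hmax v hv
      rw [hc] at this
      exact_mod_cast this)
    have hlt : (c : ℝ) < ∑ i, z i * a i := by
      have h1 : (c : ℝ) = ∑ i, v0 i * a i := by rw [hc]; simp
      rw [h1, hdot, hdot]
      exact mul_lt_mul_of_pos_left (hq v0 hv0) hNr
    have hle : ∑ i, z i * a i ≤ c := by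
      rw [hsum]
      simp only [Finset.sum_apply, Finset.mul_sum]
      rw [Finset.sum_comm]
      calc _ ≤ ∑ k : Fin c, (1 : ℝ) := Finset.sum_le_sum fun k _ => hz _ (hg k).1
        _ = c := by simp
    linarith
  · intro z hz y hy
    have := dot_le_convexHull (S := (V : Set (Fin n → ℝ))) (v := y) (b := 1)
      (fun g hg => by
        have := H2 g hg y hy
        simpa [mul_comm] using this) z hz
    simpa [mul_comm] using this

lemma abstract_main {n : ℕ} (K : Set (Fin n → ℝ)) (hK : Convex ℝ K)
    (V : Finset (Fin n → ℝ)) (hV : ∀ v ∈ V, IsLatticePoint v) (hV0 : 0 ∈ V)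
    (H2 : ∀ v ∈ V, ∀ g ∈ K, ∑ i, v i * g i ≤ 1)
    (H3 : ∀ (a : Fin n → ℝ) (m : ℕ), IsLatticePoint a → (∀ v ∈ V, ∑ i, v i * a i ≤ m) →
      ∃ f : Fin m → Fin n → ℝ, (∀ k, f k ∈ K ∧ IsLatticePoint (f k)) ∧ a = ∑ k, f k) :
    IsReflexive K ∧ HasIDP K := by
  refine ⟨⟨abstract_zero_interior K hK V H3, V, hV, abstract_dual K V hV hV0 H2 H3⟩, ?_⟩
  intro m _ a ha ham
  obtain ⟨g, hg, rfl⟩ := ham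
  apply H3 _ m ha
  intro v hv
  have h1 := H2 v hv g hg
  have h2 : ∑ i, v i * ((m : ℝ) • g) i = m * ∑ i, v i * g i := by
    rw [Finset.mul_sum]
    exact Finset.sum_congr rfl fun i _ => by simp; ring
  simp only [] at *
  rw [h2]
  exact mul_le_of_le_one_right (Nat.cast_nonneg m) h1

lemma count_sum (p q T : ℕ) (h : p + q ≤ T) :
    ∑ k : Fin T, (if p ≤ (k : ℕ) ∧ (k : ℕ) < p + q then (1 : ℝ) else 0) = q := by
  rw [Fin.sum_univ_eq_sum_range (fun k => if p ≤ k ∧ k < p + q then (1 : ℝ) else 0) T,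
    Finset.sum_boole]
  have : (Finset.range T).filter (fun k => p ≤ k ∧ k < p + q) = Finset.Ico p (p + q) := by
    ext k
    simp only [Finset.mem_filter, Finset.mem_range, Finset.mem_Ico]
    omega
  rw [this]
  simp

lemma ideal_decomp {d : ℕ} (P : PartialOrder (Fin d)) (x : Fin d → ℕ) (S : ℕ)
    (hx : ∀ i j, P.le i j → x j ≤ x i) (hS : ∀ i, x i ≤ S) :
    ∃ I : Fin S → Set (Fin d), (∀ k, IsPosetIdeal P (I k)) ∧
      ∀ i, (x i : ℝ) = ∑ k, indicator (I k) i := by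
  classical
  refine ⟨fun k => {i | 0 ≤ (k : ℕ) ∧ (k : ℕ) < 0 + x i}, ?_, ?_⟩
  · intro k i hi j hji
    have := hx j i hji
    simp only [Set.mem_ofPred_eq] at hi ⊢
    omega
  · intro i
    rw [← count_sum 0 (x i) S (by simpa using hS i)]
    refine Finset.sum_congr rfl fun k _ => ?_
    simp only [indicator, Set.indicator_apply, Set.mem_ofPred_eq]

/-- A chain of `Q`. -/
def IsPosetChain {d : ℕ} (Q : PartialOrder (Fin d)) (c : Finset (Fin d)) : Prop :=
  ∀ i ∈ c, ∀ j ∈ c, Q.le i j ∨ Q.le j i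

lemma antichain_decomp {d : ℕ} (Q : PartialOrder (Fin d)) (y : Fin d → ℕ) (T : ℕ)
    (hT : ∀ c : Finset (Fin d), IsPosetChain Q c → ∑ i ∈ c, y i ≤ T) :
    ∃ A : Fin T → Set (Fin d), (∀ k, IsPosetAntichain Q (A k)) ∧
      ∀ i, (y i : ℝ) = ∑ k, indicator (A k) i := by
  classical
  let D : Fin d → Finset (Finset (Fin d)) := fun i =>
    Finset.univ.filter (fun c => IsPosetChain Q c ∧ ∀ l ∈ c, Q.le l i ∧ l ≠ i)
  let ht : Fin d → ℕ := fun i => (D i).sup (fun c => ∑ l ∈ c, y l)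
  have hins : ∀ i, ∃ c, IsPosetChain Q c ∧ (∀ l ∈ c, Q.le l i) ∧
      ∑ l ∈ c, y l = ht i + y i := by
    intro i
    have hne : (D i).Nonempty := ⟨∅, Finset.mem_filter.2 ⟨Finset.mem_univ _,
      fun _ h => (Finset.notMem_empty _ h).elim, fun _ h => (Finset.notMem_empty _ h).elim⟩⟩
    obtain ⟨c, hc, hce⟩ := Finset.exists_mem_eq_sup (D i) hne (fun c => ∑ l ∈ c, y l)
    simp only [D, Finset.mem_filter, Finset.mem_univ, true_and] at hc
    refine ⟨insert i c, ?_, ?_, ?_⟩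
    · intro a ha b hb
      rw [Finset.mem_insert] at ha hb
      rcases ha with rfl | ha <;> rcases hb with rfl | hb
      · exact Or.inl (Q.le_refl _)
      · exact Or.inr (hc.2 b hb).1
      · exact Or.inl (hc.2 a ha).1
      · exact hc.1 a ha b hb
    · intro l hl
      rw [Finset.mem_insert] at hl
      rcases hl with rfl | hl
      · exact Q.le_refl _
      · exact (hc.2 l hl).1
    · rw [Finset.sum_insert (fun h => (hc.2 i h).2 rfl), add_comm]
      exact congrArg (· + y i) hce.symm
  have hlt : ∀ i j, Q.le i j → i ≠ j → ht i + y i ≤ ht j := by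
    intro i j hij hne
    obtain ⟨c, hc, hci, hs⟩ := hins i
    rw [← hs]
    apply Finset.le_sup (f := fun c => ∑ l ∈ c, y l)
    simp only [D, Finset.mem_filter, Finset.mem_univ, true_and]
    refine ⟨hc, fun l hl => ⟨Q.le_trans _ _ _ (hci l hl) hij, ?_⟩⟩
    rintro rfl
    exact hne (Q.le_antisymm _ _ hij (hci l hl))
  refine ⟨fun k => {i | ht i ≤ (k : ℕ) ∧ (k : ℕ) < ht i + y i}, ?_, ?_⟩
  · intro k i hi j hj hne
    simp only [Set.mem_ofPred_eq] at hi hj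
    constructor
    · intro h
      have := hlt i j h hne
      omega
    · intro h
      have := hlt j i h hne.symm
      omega
  · intro i
    obtain ⟨c, hc, -, hs⟩ := hins i
    rw [← count_sum (ht i) (y i) T (hs ▸ hT c hc)]
    refine Finset.sum_congr rfl fun k _ => ?_
    simp only [indicator, Set.indicator_apply, Set.mem_ofPred_eq]

/-- Evaluation of an optional coordinate. -/
noncomputable def oval {d : ℕ} (a : Fin d → ℝ) (o : Option (Fin d)) : ℝ := o.elim 0 a

/-- The functional of an optional coordinate. -/
noncomputable def ovec {d : ℕ} (o : Option (Fin d)) : Fin d → ℝ :=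
  o.elim 0 (fun i => Pi.single i 1)

/-- The functional attached to a chain and a choice function. -/
noncomputable def cvec {d : ℕ} (c : Finset (Fin d)) (j : Fin d → Option (Fin d)) : Fin d → ℝ :=
  ∑ i ∈ c, (ovec (j i) - Pi.single i 1)

lemma ovec_dot {d : ℕ} (a : Fin d → ℝ) (o : Option (Fin d)) :
    ∑ i, ovec o i * a i = oval a o := by
  cases o <;> simp [ovec, oval, Pi.single_apply]

lemma cvec_dot {d : ℕ} (a : Fin d → ℝ) (c : Finset (Fin d)) (j : Fin d → Option (Fin d)) :
    ∑ i, cvec c j i * a i = ∑ i ∈ c, (oval a (j i) - a i) := by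
  simp only [cvec, Finset.sum_apply, Finset.sum_mul]
  rw [Finset.sum_comm]
  refine Finset.sum_congr rfl fun l _ => ?_
  simp only [Pi.sub_apply, sub_mul, Finset.sum_sub_distrib, ovec_dot]
  simp [Pi.single_apply]

lemma single_lattice {d : ℕ} (i : Fin d) : IsLatticePoint (Pi.single i 1 : Fin d → ℝ) := by
  intro l
  by_cases h : l = i
  · subst h; exact ⟨1, by simp⟩
  · exact ⟨0, by simp [h]⟩

lemma ovec_lattice {d : ℕ} (o : Option (Fin d)) : IsLatticePoint (ovec o) := by
  cases o with
  | none => exact fun i => ⟨0, by simp [ovec]⟩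
  | some i => exact single_lattice i

lemma cvec_lattice {d : ℕ} (c : Finset (Fin d)) (j : Fin d → Option (Fin d)) :
    IsLatticePoint (cvec c j) := by
  intro l
  choose p hp using fun i => ovec_lattice (j i) l
  choose q hq using fun i : Fin d => single_lattice i l
  exact ⟨∑ i ∈ c, (p i - q i), by simp [cvec, hp, hq]⟩

/-- A choice function only picks larger elements. -/
def ValidChoice {d : ℕ} (P : PartialOrder (Fin d)) (j : Fin d → Option (Fin d)) : Prop :=
  ∀ i, ∀ l ∈ j i, P.le i l

lemma indicator_nonneg {d : ℕ} (S : Set (Fin d)) (i : Fin d) : 0 ≤ indicator S i :=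
  Set.indicator_nonneg (fun _ _ => zero_le_one) i

lemma indicator_le_one {d : ℕ} (S : Set (Fin d)) (i : Fin d) : indicator S i ≤ 1 := by
  classical
  simp only [indicator, Set.indicator_apply]
  split_ifs <;> norm_num

lemma ovec_order {d : ℕ} (P : PartialOrder (Fin d)) (o : Option (Fin d)) :
    ∀ g ∈ orderPolytope P, ∑ i, ovec o i * g i ≤ 1 := by
  apply dot_le_convexHull
  rintro g ⟨I, hI, rfl⟩
  rw [ovec_dot]
  cases o with
  | none => simp [oval]
  | some i => exact indicator_le_one I i

lemma ovec_chain {d : ℕ} (Q : PartialOrder (Fin d)) (o : Option (Fin d)) :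
    ∀ g ∈ -chainPolytope Q, ∑ i, ovec o i * g i ≤ 0 := by
  intro g hg
  have := dot_le_convexHull (v := -ovec o) (b := 0)
    (S := {x | ∃ A : Set (Fin d), IsPosetAntichain Q A ∧ x = indicator A}) (by
      rintro g ⟨A, hA, rfl⟩
      simp only [Pi.neg_apply, neg_mul, Finset.sum_neg_distrib, ovec_dot]
      cases o with
      | none => simp [oval]
      | some i => simpa [oval] using indicator_nonneg A i) (-g) hg
  simpa using this

lemma cvec_order {d : ℕ} (P : PartialOrder (Fin d)) (c : Finset (Fin d))
    (j : Fin d → Option (Fin d)) (hj : ValidChoice P j) :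
    ∀ g ∈ orderPolytope P, ∑ i, cvec c j i * g i ≤ 0 := by
  classical
  apply dot_le_convexHull
  rintro g ⟨I, hI, rfl⟩
  rw [cvec_dot]
  apply Finset.sum_nonpos
  intro i _
  rw [sub_nonpos]
  rcases h : j i with _ | l
  · simpa [oval] using indicator_nonneg I i
  · have hil := hj i l h
    simp only [oval, Option.elim, indicator, Set.indicator_apply]
    by_cases hl : l ∈ I
    · simp [hl, hI l hl i hil]
    · simp only [hl, if_false]; split_ifs <;> norm_num

lemma cvec_chain {d : ℕ} (Q : PartialOrder (Fin d)) (c : Finset (Fin d))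
    (hc : IsPosetChain Q c) (j : Fin d → Option (Fin d)) :
    ∀ g ∈ -chainPolytope Q, ∑ i, cvec c j i * g i ≤ 1 := by
  classical
  intro g hg
  have := dot_le_convexHull (v := -cvec c j) (b := 1)
    (S := {x | ∃ A : Set (Fin d), IsPosetAntichain Q A ∧ x = indicator A}) (by
      rintro g ⟨A, hA, rfl⟩
      simp only [Pi.neg_apply, neg_mul, Finset.sum_neg_distrib, cvec_dot]
      rw [← Finset.sum_neg_distrib]
      have h1 : ∑ i ∈ c, -(oval (indicator A) (j i) - indicator A i) ≤
          ∑ i ∈ c, if i ∈ A then (1 : ℝ) else 0 := by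
        apply Finset.sum_le_sum
        intro i _
        have h0 : 0 ≤ oval (indicator A) (j i) := by
          rcases j i with _ | l
          · simp [oval]
          · exact indicator_nonneg A l
        have h2 : indicator A i = if i ∈ A then (1 : ℝ) else 0 := by
          simp only [indicator, Set.indicator_apply]
        linarith
      refine h1.trans ?_
      rw [Finset.sum_boole]
      have : (c.filter (· ∈ A)).card ≤ 1 := by
        rw [Finset.card_le_one]
        intro a ha b hb
        rw [Finset.mem_filter] at ha hb
        by_contra hne
        have := hA a ha.2 b hb.2 hne
        rcases hc a ha.1 b hb.1 with h | h
        · exact this.1 h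
        · exact this.2 h
      exact_mod_cast this) (-g) hg
  simpa using this

lemma core_decomp {d : ℕ} (P Q : PartialOrder (Fin d)) (a : Fin d → ℝ) (ha : IsLatticePoint a) :
    ∃ (s t : ℕ) (o : Option (Fin d)) (c : Finset (Fin d)) (j : Fin d → Option (Fin d)),
      IsPosetChain Q c ∧ ValidChoice P j ∧
      ∑ i, ovec o i * a i = s ∧ ∑ i, cvec c j i * a i = t ∧
      ∀ S T : ℕ, s ≤ S → t ≤ T →
        ∃ (I : Fin S → Set (Fin d)) (A : Fin T → Set (Fin d)),
          (∀ k, IsPosetIdeal P (I k)) ∧ (∀ k, IsPosetAntichain Q (A k)) ∧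
          a = ∑ k, indicator (I k) + ∑ k, -indicator (A k) := by
  classical
  choose z hz using ha
  have htn : ∀ l : Fin d, ((z l).toNat : ℝ) = oval a (if 0 ≤ z l then some l else none) := by
    intro l
    split_ifs with h
    · have : ((z l).toNat : ℤ) = z l := Int.toNat_of_nonneg h
      simp only [oval, Option.elim, hz]
      exact_mod_cast this
    · have : (z l).toNat = 0 := Int.toNat_of_nonpos (by omega)
      simp [this, oval]
  let U : Fin d → Finset (Fin d) := fun i => Finset.univ.filter (fun l => P.le i l)
  let x : Fin d → ℕ := fun i => (U i).sup (fun l => (z l).toNat)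
  have hself : ∀ i, i ∈ U i := fun i => by
    simp only [U, Finset.mem_filter, Finset.mem_univ, true_and]; exact P.le_refl i
  have hxz : ∀ i, z i ≤ x i := by
    intro i
    have h1 : (z i).toNat ≤ x i := Finset.le_sup (f := fun l => (z l).toNat) (hself i)
    omega
  have hxanti : ∀ i j, P.le i j → x j ≤ x i := by
    intro i j hij
    apply Finset.sup_mono
    intro l hl
    simp only [U, Finset.mem_filter, Finset.mem_univ, true_and] at hl ⊢
    exact P.le_trans _ _ _ hij hl
  have hj : ∀ i, ∃ o : Option (Fin d), (∀ l ∈ o, P.le i l) ∧ (x i : ℝ) = oval a o := by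
    intro i
    obtain ⟨l, hl, hle⟩ := Finset.exists_mem_eq_sup (U i) ⟨i, hself i⟩ (fun l => (z l).toNat)
    simp only [U, Finset.mem_filter, Finset.mem_univ, true_and] at hl
    refine ⟨if 0 ≤ z l then some l else none, ?_, ?_⟩
    · intro m hm
      split_ifs at hm
      · simp at hm; subst hm; exact hl
      · simp at hm
    · rw [← htn]
      exact congrArg _ hle
  choose j hjv hjx using hj
  let y : Fin d → ℕ := fun i => ((x i : ℤ) - z i).toNat
  have hy : ∀ i, (y i : ℝ) = x i - a i := by
    intro i
    have : (y i : ℤ) = x i - z i := Int.toNat_of_nonneg (by have := hxz i; omega)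
    rw [hz]
    exact_mod_cast this
  let s : ℕ := Finset.univ.sup (fun l => (z l).toNat)
  have ho : ∃ o, oval a o = s := by
    rcases (Finset.univ : Finset (Fin d)).eq_empty_or_nonempty with h | h
    · exact ⟨none, by simp [s, h, oval]⟩
    · obtain ⟨l, -, hl⟩ := Finset.exists_mem_eq_sup Finset.univ h (fun l => (z l).toNat)
      exact ⟨_, (htn l).symm.trans (congrArg _ hl.symm)⟩
  obtain ⟨o, ho⟩ := ho
  let Ch : Finset (Finset (Fin d)) := Finset.univ.filter (IsPosetChain Q)
  obtain ⟨c, hc, hct⟩ := Finset.exists_mem_eq_sup Ch ⟨∅, by simp [Ch, IsPosetChain]⟩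
    (fun c => ∑ i ∈ c, y i)
  simp only [Ch, Finset.mem_filter, Finset.mem_univ, true_and] at hc
  refine ⟨s, ∑ i ∈ c, y i, o, c, j, hc, hjv, ?_, ?_, ?_⟩
  · rw [ovec_dot, ho]
  · rw [cvec_dot]
    push_cast
    exact Finset.sum_congr rfl fun i _ => by rw [hy, hjx]
  · intro S T hS hT
    obtain ⟨I, hI, hIx⟩ := ideal_decomp P x S hxanti (fun i =>
      (Finset.sup_mono (Finset.subset_univ _)).trans hS)
    obtain ⟨A, hA, hAy⟩ := antichain_decomp Q y T (fun c' hc' => by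
      refine le_trans ?_ hT
      have : ∑ i ∈ c', y i ≤ Ch.sup (fun c => ∑ i ∈ c, y i) :=
        Finset.le_sup (f := fun c => ∑ i ∈ c, y i) (by simp [Ch, hc'])
      exact this.trans hct.le)
    refine ⟨I, A, hI, hA, ?_⟩
    funext i
    have h1 := hy i
    rw [hIx, hAy] at h1
    simp only [Pi.add_apply, Finset.sum_apply, Pi.neg_apply, Finset.sum_neg_distrib]
    linarith

lemma combine {n : ℕ} {K : Set (Fin n → ℝ)} (h0 : (0 : Fin n → ℝ) ∈ K) {S T m : ℕ}
    (h : S + T ≤ m) (f : Fin S → Fin n → ℝ) (g : Fin T → Fin n → ℝ)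
    (hf : ∀ k, f k ∈ K ∧ IsLatticePoint (f k)) (hg : ∀ k, g k ∈ K ∧ IsLatticePoint (g k)) :
    ∃ F : Fin m → Fin n → ℝ, (∀ k, F k ∈ K ∧ IsLatticePoint (F k)) ∧
      ∑ k, f k + ∑ k, g k = ∑ k, F k := by
  obtain ⟨r, rfl⟩ := Nat.exists_eq_add_of_le h
  refine ⟨Fin.append (Fin.append f g) (fun _ => 0), ?_, ?_⟩
  · intro k
    refine Fin.addCases (fun k => ?_) (fun k => ?_) k
    · rw [Fin.append_left]
      refine Fin.addCases (fun k => ?_) (fun k => ?_) k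
      · rw [Fin.append_left]; exact hf k
      · rw [Fin.append_right]; exact hg k
    · rw [Fin.append_right]
      exact ⟨h0, fun i => ⟨0, by simp⟩⟩
  · simp [Fin.sum_univ_add]

lemma indicator_lattice {d : ℕ} (S : Set (Fin d)) : IsLatticePoint (indicator S) := by
  classical
  intro i
  by_cases h : i ∈ S
  · exact ⟨1, by simp [indicator, h]⟩
  · exact ⟨0, by simp [indicator, h]⟩

lemma neg_lattice {d : ℕ} {v : Fin d → ℝ} (hv : IsLatticePoint v) : IsLatticePoint (-v) := by
  intro i
  obtain ⟨z, hz⟩ := hv i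
  exact ⟨-z, by simp [hz]⟩

lemma snoc_lattice {d : ℕ} {v : Fin d → ℝ} (hv : IsLatticePoint v) (h : ℤ) :
    IsLatticePoint (Fin.snoc v (h : ℝ) : Fin (d + 1) → ℝ) := by
  intro i
  refine Fin.lastCases ⟨h, by simp⟩ (fun l => ?_) i
  obtain ⟨z, hz⟩ := hv l
  exact ⟨z, by simp [hz]⟩

lemma mem_order {d : ℕ} {P : PartialOrder (Fin d)} {I : Set (Fin d)} (h : IsPosetIdeal P I) :
    indicator I ∈ orderPolytope P := subset_convexHull ℝ _ ⟨I, h, rfl⟩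

lemma mem_chain {d : ℕ} {Q : PartialOrder (Fin d)} {A : Set (Fin d)}
    (h : IsPosetAntichain Q A) :
    -indicator A ∈ -chainPolytope Q :=
  Set.neg_mem_neg.2 (subset_convexHull ℝ _ ⟨A, h, rfl⟩)

lemma zero_mem_order {d : ℕ} (P : PartialOrder (Fin d)) : (0 : Fin d → ℝ) ∈ orderPolytope P := by
  have := mem_order (P := P) (I := ∅) (fun _ h => h.elim)
  have h0 : indicator (∅ : Set (Fin d)) = 0 := by funext i; simp [indicator]
  rwa [h0] at this

lemma zero_mem_chain {d : ℕ} (Q : PartialOrder (Fin d)) : (0 : Fin d → ℝ) ∈ -chainPolytope Q := by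
  have := mem_chain (Q := Q) (A := ∅) (fun _ h => h.elim)
  have h0 : indicator (∅ : Set (Fin d)) = 0 := by funext i; simp [indicator]
  rwa [h0, neg_zero] at this

lemma gamma_main (d : ℕ) (P Q : PartialOrder (Fin d)) :
    IsReflexive (gammaPolytope (orderPolytope P) (chainPolytope Q)) ∧
      HasIDP (gammaPolytope (orderPolytope P) (chainPolytope Q)) := by
  classical
  have hfin : {v : Fin d → ℝ | ∃ (o : Option (Fin d)) (c : Finset (Fin d))
      (j : Fin d → Option (Fin d)), IsPosetChain Q c ∧ ValidChoice P j ∧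
        v = ovec o + cvec c j}.Finite := by
    refine (Set.finite_range (fun p : Option (Fin d) × Finset (Fin d) ×
      (Fin d → Option (Fin d)) => (ovec p.1 + cvec p.2.1 p.2.2 : Fin d → ℝ))).subset ?_
    rintro v ⟨o, c, j, -, -, rfl⟩
    exact ⟨(o, c, j), rfl⟩
  have hdot : ∀ (o : Option (Fin d)) (c : Finset (Fin d)) (j : Fin d → Option (Fin d))
      (a : Fin d → ℝ), ∑ i, (ovec o + cvec c j) i * a i =
        ∑ i, ovec o i * a i + ∑ i, cvec c j i * a i := by
    intro o c j a
    simp only [Pi.add_apply, add_mul, Finset.sum_add_distrib]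
  apply abstract_main _ (convex_convexHull ℝ _) hfin.toFinset
  · intro v hv
    rw [Set.Finite.mem_toFinset] at hv
    obtain ⟨o, c, j, -, -, rfl⟩ := hv
    intro i
    obtain ⟨p, hp⟩ := ovec_lattice o i
    obtain ⟨q, hq⟩ := cvec_lattice c j i
    exact ⟨p + q, by simp [hp, hq]⟩
  · rw [Set.Finite.mem_toFinset]
    exact ⟨none, ∅, fun _ => none, by simp [IsPosetChain], by simp [ValidChoice],
      by funext i; simp [ovec, cvec]⟩
  · intro v hv
    rw [Set.Finite.mem_toFinset] at hv
    obtain ⟨o, c, j, hc, hj, rfl⟩ := hv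
    apply dot_le_convexHull
    rintro g (hg | hg)
    · rw [hdot]
      have := ovec_order P o g hg
      have := cvec_order P c j hj g hg
      linarith
    · rw [hdot]
      have := ovec_chain Q o g hg
      have := cvec_chain Q c hc j g hg
      linarith
  · intro a m ha hm
    obtain ⟨s, t, o, c, j, hc, hj, hs, ht, hdec⟩ := core_decomp P Q a ha
    have h1 := hm (ovec o + cvec c j) (by
      rw [Set.Finite.mem_toFinset]
      exact ⟨o, c, j, hc, hj, rfl⟩)
    rw [hdot, hs, ht] at h1
    have h2 : s + t ≤ m := by exact_mod_cast h1
    obtain ⟨I, A, hI, hA, hsum⟩ := hdec s t le_rfl le_rfl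
    rw [hsum]
    apply combine (subset_convexHull ℝ _ (Or.inl (zero_mem_order P))) h2
    · intro k
      exact ⟨subset_convexHull ℝ _ (Or.inl (mem_order (hI k))), indicator_lattice _⟩
    · intro k
      exact ⟨subset_convexHull ℝ _ (Or.inr (mem_chain (hA k))),
        neg_lattice (indicator_lattice _)⟩

lemma omega_main (d : ℕ) (P Q : PartialOrder (Fin d)) :
    IsReflexive (omegaPolytope (orderPolytope P) (chainPolytope Q)) ∧
      HasIDP (omegaPolytope (orderPolytope P) (chainPolytope Q)) := by
  classical
  let V1 : Set (Fin (d + 1) → ℝ) := Set.range (fun o : Option (Fin d) =>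
    (Fin.snoc ((2 : ℝ) • ovec o) ((-1 : ℤ) : ℝ) : Fin (d + 1) → ℝ))
  let V2 : Set (Fin (d + 1) → ℝ) := {v | ∃ (c : Finset (Fin d))
      (j : Fin d → Option (Fin d)), IsPosetChain Q c ∧ ValidChoice P j ∧
        v = (Fin.snoc ((2 : ℝ) • cvec c j) ((1 : ℤ) : ℝ) : Fin (d + 1) → ℝ)}
  have hfin2 : V2.Finite := by
    refine (Set.finite_range (fun p : Finset (Fin d) × (Fin d → Option (Fin d)) =>
      (Fin.snoc ((2 : ℝ) • cvec p.1 p.2) ((1 : ℤ) : ℝ) : Fin (d + 1) → ℝ))).subset ?_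
    rintro v ⟨c, j, -, -, rfl⟩
    exact ⟨(c, j), rfl⟩
  have hfin : ({0} ∪ V1 ∪ V2).Finite :=
    ((Set.finite_singleton _).union (Set.finite_range _)).union hfin2
  have hdot : ∀ (w a : Fin d → ℝ) (p q : ℝ),
      ∑ i, (Fin.snoc ((2 : ℝ) • w) p : Fin (d + 1) → ℝ) i * (Fin.snoc a q : Fin (d + 1) → ℝ) i =
        2 * ∑ i, w i * a i + p * q := by
    intro w a p q
    rw [Fin.sum_univ_castSucc]
    simp [Finset.mul_sum, mul_assoc]
  have hlat2 : ∀ w : Fin d → ℝ, IsLatticePoint w → IsLatticePoint ((2 : ℝ) • w) := by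
    intro w hw i
    obtain ⟨z, hz⟩ := hw i
    exact ⟨2 * z, by simp [hz]⟩
  have hz1 : (Fin.snoc (0 : Fin d → ℝ) (1 : ℝ) : Fin (d + 1) → ℝ) ∈
      omegaPolytope (orderPolytope P) (chainPolytope Q) :=
    subset_convexHull ℝ _ (Or.inl ⟨0, zero_mem_order P, rfl⟩)
  have hz2 : (Fin.snoc (0 : Fin d → ℝ) (-1 : ℝ) : Fin (d + 1) → ℝ) ∈
      omegaPolytope (orderPolytope P) (chainPolytope Q) :=
    subset_convexHull ℝ _ (Or.inr ⟨0, zero_mem_chain Q, rfl⟩)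
  have hconv : Convex ℝ (omegaPolytope (orderPolytope P) (chainPolytope Q)) :=
    convex_convexHull ℝ _
  have hz : (0 : Fin (d + 1) → ℝ) ∈ omegaPolytope (orderPolytope P) (chainPolytope Q) := by
    have := hconv hz1 hz2 (a := 1 / 2) (b := 1 / 2) (by norm_num) (by norm_num) (by norm_num)
    convert this using 1
    funext i
    refine Fin.lastCases ?_ (fun l => ?_) i <;> simp
  apply abstract_main _ hconv hfin.toFinset
  · intro v hv
    rw [Set.Finite.mem_toFinset] at hv
    rcases hv with (hv | ⟨o, rfl⟩) | ⟨c, j, -, -, rfl⟩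
    · rw [Set.mem_singleton_iff] at hv
      subst hv
      exact fun i => ⟨0, by simp⟩
    · exact snoc_lattice (hlat2 _ (ovec_lattice o)) (-1)
    · exact snoc_lattice (hlat2 _ (cvec_lattice c j)) 1
  · rw [Set.Finite.mem_toFinset]
    exact Or.inl (Or.inl rfl)
  · intro v hv
    rw [Set.Finite.mem_toFinset] at hv
    apply dot_le_convexHull
    rcases hv with (hv | ⟨o, rfl⟩) | ⟨c, j, hc, hj, rfl⟩
    · rw [Set.mem_singleton_iff] at hv
      subst hv
      intro g _
      simp
    · rintro g (⟨x, hx, rfl⟩ | ⟨x, hx, rfl⟩)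
      · simp only []
        rw [hdot]
        have := ovec_order P o x hx
        push_cast; linarith
      · simp only []
        rw [hdot]
        have := ovec_chain Q o x hx
        push_cast; linarith
    · rintro g (⟨x, hx, rfl⟩ | ⟨x, hx, rfl⟩)
      · simp only []
        rw [hdot]
        have := cvec_order P c j hj x hx
        push_cast; linarith
      · simp only []
        rw [hdot]
        have := cvec_chain Q c hc j x hx
        push_cast; linarith
  · intro a' m ha' hm
    obtain ⟨a, h, rfl⟩ : ∃ (a : Fin d → ℝ) (h : ℝ), a' = Fin.snoc a h :=
      ⟨Fin.init a', a' (Fin.last d), (Fin.snoc_init_self a').symm⟩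
    have ha : IsLatticePoint a := fun i => by simpa using ha' i.castSucc
    obtain ⟨z, hzh⟩ := ha' (Fin.last d)
    rw [Fin.snoc_last] at hzh
    subst hzh
    obtain ⟨s, t, o, c, j, hc, hj, hs, ht, hdec⟩ := core_decomp P Q a ha
    have h1 := hm (Fin.snoc ((2 : ℝ) • ovec o) ((-1 : ℤ) : ℝ)) (by
      rw [Set.Finite.mem_toFinset]
      exact Or.inl (Or.inr ⟨o, rfl⟩))
    have h2 := hm (Fin.snoc ((2 : ℝ) • cvec c j) ((1 : ℤ) : ℝ)) (by
      rw [Set.Finite.mem_toFinset]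
      exact Or.inr ⟨c, j, hc, hj, rfl⟩)
    rw [hdot, hs] at h1
    rw [hdot, ht] at h2
    have h1' : 2 * (s : ℤ) + -1 * z ≤ m := by exact_mod_cast h1
    have h2' : 2 * (t : ℤ) + 1 * z ≤ m := by exact_mod_cast h2
    obtain ⟨S, T, hS, hT, hST, hm'⟩ : ∃ S T : ℕ, s ≤ S ∧ t ≤ T ∧ (S : ℤ) - T = z ∧ S + T ≤ m := by
      rcases le_total (t : ℤ) (s - z) with hle | hle
      · exact ⟨s, (s - z).toNat, by omega, by omega, by omega, by omega⟩
      · exact ⟨(t + z).toNat, t, by omega, by omega, by omega, by omega⟩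
    obtain ⟨I, A, hI, hA, hsum⟩ := hdec S T hS hT
    obtain ⟨F, hF, hFs⟩ := combine hz hm'
      (fun k => (Fin.snoc (indicator (I k)) (1 : ℝ) : Fin (d + 1) → ℝ))
      (fun k => (Fin.snoc (-indicator (A k)) (-1 : ℝ) : Fin (d + 1) → ℝ))
      (fun k => ⟨subset_convexHull ℝ _ (Or.inl ⟨_, mem_order (hI k), rfl⟩),
        by simpa using snoc_lattice (indicator_lattice (I k)) 1⟩)
      (fun k => ⟨subset_convexHull ℝ _ (Or.inr ⟨_, mem_chain (hA k), rfl⟩),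
        by simpa using snoc_lattice (neg_lattice (indicator_lattice (A k))) (-1)⟩)
    refine ⟨F, hF, ?_⟩
    rw [← hFs]
    funext i
    refine Fin.lastCases ?_ (fun l => ?_) i
    · simp only [Fin.snoc_last, Pi.add_apply, Finset.sum_apply]
      rw [← hST]
      simp
      ring
    · simp only [Fin.snoc_castSucc, Pi.add_apply, Finset.sum_apply]
      rw [hsum]
      simp

/-- **Theorem (Hibi–Matsuda–Tsuchiya).** For posets `P` and `Q` on `[d]` (`d ≥ 1`), each of
`Γ(O_P, C_Q)` and `Ω(O_P, C_Q)` is a reflexive polytope with the integer decomposition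
property. -/
theorem gamma_omega_order_chain_reflexive_idp (d : ℕ) (hd : 1 ≤ d)
    (P Q : PartialOrder (Fin d)) :
    (IsReflexive (gammaPolytope (orderPolytope P) (chainPolytope Q)) ∧
      HasIDP (gammaPolytope (orderPolytope P) (chainPolytope Q))) ∧
    (IsReflexive (omegaPolytope (orderPolytope P) (chainPolytope Q)) ∧
      HasIDP (omegaPolytope (orderPolytope P) (chainPolytope Q))) := by
  exact ⟨gamma_main d P Q, omega_main d P Q⟩

end HibiTsuchiya
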